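/- Let ψ be a non-negative Schwartz function on ℝ² and let π be a finite Borel measure on ℝ² with compact support. Then there exists a constant C > 0 (depending on ψ and on the total mass of π) such that for all 0 < δ ≤ 1 and all z ∈ ℝ² with dist(z, spt(π)) ≥ √δ, one has (π * ψ_δ)(z) ≤ C·δ. -/

import Mathlib

open MeasureTheory

/-- The topological support of a Borel measure on `ℝ × ℝ`. -/
def msupport (π : Measure (ℝ × ℝ)) : Set (ℝ × ℝ) :=
  {x | ∀ U : Set (ℝ × ℝ), IsOpen U → x ∈ U → 0 < π U}

/-- Almost every point lies in the topological support. -/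
theorem ae_mem_msupport (π : Measure (ℝ × ℝ)) : ∀ᵐ w ∂π, w ∈ msupport π := by
  filter_upwards [Measure.support_mem_ae (μ := π)] with w hw U hU hwU
  exact (Measure.mem_support_iff_forall w).mp hw U (hU.mem_nhds hwU)

/-- The squared Euclidean length is at most twice the squared sup norm. -/
theorem sq_add_sq_le_two_mul_norm_sq (v : ℝ × ℝ) : v.1 ^ 2 + v.2 ^ 2 ≤ 2 * ‖v‖ ^ 2 := by
  have h₁ : v.1 ^ 2 ≤ ‖v‖ ^ 2 := sq_le_sq.mpr (by simpa using norm_fst_le v)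
  have h₂ : v.2 ^ 2 ≤ ‖v‖ ^ 2 := sq_le_sq.mpr (by simpa using norm_snd_le v)
  linarith

/-- Decay of order six gives a linear bound for the rescaled function at distance `√δ`. -/
theorem inv_sq_mul_apply_inv_smul_le {f : ℝ × ℝ → ℝ} {K δ : ℝ}
    (hf : ∀ x, 0 ≤ f x) (hK : ∀ x, ‖x‖ ^ 6 * f x ≤ K) (hδ : 0 < δ)
    {v : ℝ × ℝ} (hv : δ ≤ v.1 ^ 2 + v.2 ^ 2) :
    (δ ^ 2)⁻¹ * f (δ⁻¹ • v) ≤ 8 * K * δ := by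
  have hnorm : δ / 2 ≤ ‖v‖ ^ 2 := by linarith [sq_add_sq_le_two_mul_norm_sq v]
  have hcube : (δ / 2) ^ 3 ≤ ‖v‖ ^ 6 := by
    calc (δ / 2) ^ 3 ≤ (‖v‖ ^ 2) ^ 3 := by gcongr
      _ = ‖v‖ ^ 6 := by ring
  have hdecay := hK (δ⁻¹ • v)
  rw [norm_smul, Real.norm_of_nonneg (inv_nonneg.mpr hδ.le), mul_pow] at hdecay
  have hle : (δ⁻¹) ^ 6 * (δ / 2) ^ 3 * f (δ⁻¹ • v) ≤ K :=
    le_trans (by gcongr; exact hf _) hdecay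
  calc (δ ^ 2)⁻¹ * f (δ⁻¹ • v)
      = 8 * ((δ⁻¹) ^ 6 * (δ / 2) ^ 3 * f (δ⁻¹ • v)) * δ := by field_simp; norm_num
    _ ≤ 8 * K * δ := by gcongr

/-- For a non-negative Schwartz function `ψ` on `ℝ²` and a compactly supported finite measure
`π`, there is `C > 0` such that `(π * ψ_δ)(z) ≤ C·δ` whenever `0 < δ ≤ 1` and the Euclidean
distance from `z` to `spt π` is at least `√δ`. -/
theorem mollified_measure_small_off_support
    (ψ : SchwartzMap (ℝ × ℝ) ℝ) (hψ : ∀ x, 0 ≤ ψ x)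
    (π : Measure (ℝ × ℝ)) [IsFiniteMeasure π] (hπ : IsCompact (msupport π)) :
    ∃ C : ℝ, 0 < C ∧
      ∀ δ : ℝ, 0 < δ → δ ≤ 1 →
        ∀ z : ℝ × ℝ,
          (∀ w ∈ msupport π,
            Real.sqrt δ ≤ Real.sqrt ((z.1 - w.1) ^ 2 + (z.2 - w.2) ^ 2)) →
          (∫ w, (δ ^ 2)⁻¹ * ψ (δ⁻¹ • (z - w)) ∂π) ≤ C * δ := by
  obtain ⟨K, hKpos, hK⟩ := ψ.decay 6 0
  have hdecay : ∀ x, ‖x‖ ^ 6 * ψ x ≤ K := fun x => by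
    simpa only [norm_iteratedFDeriv_zero, Real.norm_of_nonneg (hψ x)] using hK x
  refine ⟨8 * K * (π.real Set.univ + 1), by positivity, fun δ hδ _ z hz => ?_⟩
  have hbound : ∀ᵐ w ∂π, (δ ^ 2)⁻¹ * ψ (δ⁻¹ • (z - w)) ≤ 8 * K * δ := by
    filter_upwards [ae_mem_msupport π] with w hw
    exact inv_sq_mul_apply_inv_smul_le hψ hdecay hδ
      ((Real.sqrt_le_sqrt_iff (by positivity)).mp (hz w hw))
  calc ∫ w, (δ ^ 2)⁻¹ * ψ (δ⁻¹ • (z - w)) ∂π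
      ≤ ∫ _, 8 * K * δ ∂π :=
        integral_mono_of_nonneg
          (.of_forall fun w => mul_nonneg (by positivity) (hψ _)) (integrable_const _) hbound
    _ = 8 * K * π.real Set.univ * δ := by
        rw [integral_const, smul_eq_mul]
        ring
    _ ≤ 8 * K * (π.real Set.univ + 1) * δ := by
        gcongr
        linarith
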